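/- The symmetric group S_6 acts on the set of (3,6) pseudo-GCOs by relabeling: a permutation ρ of {1,…,6} sends (σ^{(1)},…,σ^{(6)}) to the tuple whose ρ(i)-th component is the (2,5) color ordering obtained by applying ρ to the labels of σ^{(i)}. This action has exactly 4 orbits, of sizes 60, 180, 120 and 12 respectively (totaling 372). -/

import Mathlib

/-- Dihedral equivalence of lists: `l₂` is obtained from `l₁` by a rotation,
possibly composed with a reversal.  Two cyclic words represent the same
(2,m) color ordering iff they are dihedrally equivalent. -/
def DihEquiv {α : Type*} (l₁ l₂ : List α) : Prop :=
  List.IsRotated l₁ l₂ ∨ List.IsRotated l₁.reverse l₂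

theorem dihEquiv_refl {α : Type*} (l : List α) : DihEquiv l l :=
  Or.inl (List.IsRotated.refl l)

theorem dihEquiv_symm {α : Type*} {l₁ l₂ : List α} (h : DihEquiv l₁ l₂) : DihEquiv l₂ l₁ := by
  rcases h with h | h
  · exact Or.inl h.symm
  · have h2 := h.reverse
    rw [List.reverse_reverse] at h2
    exact Or.inr h2.symm

theorem dihEquiv_trans {α : Type*} {l₁ l₂ l₃ : List α} (h : DihEquiv l₁ l₂)
    (h' : DihEquiv l₂ l₃) : DihEquiv l₁ l₃ := by
  rcases h with h | h <;> rcases h' with h' | h'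
  · exact Or.inl (h.trans h')
  · exact Or.inr (h.reverse.trans h')
  · exact Or.inr (h.trans h')
  · have h2 := h.reverse
    rw [List.reverse_reverse] at h2
    exact Or.inl (h2.trans h')

/-- A `(k, S.card)` pre-GCO on the label set `S`, given by representatives: to every
`(k-2)`-element subset `I ⊆ S` it assigns a cyclic word on `S \ I` (a representative of
a `(2, S.card - k + 2)` color ordering).  Values of `σ` on other subsets are irrelevant. -/
def IsPreGCO (k : ℕ) (S : Finset ℕ) (σ : Finset ℕ → List ℕ) : Prop :=
  ∀ I : Finset ℕ, I ⊆ S → I.card = k - 2 →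
    (σ I).Nodup ∧ (σ I).toFinset = S \ I

/-- The recursive pseudo-GCO condition on a `(k, S.card)` pre-GCO (given by
representatives).  For `S.card = k + 2` it says that the pre-GCO is the descendant of a
`(2, k+2)` color ordering (represented by `base`); for `S.card > k + 2` it requires all
`k`-preserving projections (delete the component at subsets containing `i`, and delete
the label `i` from the remaining components) to be pseudo-GCOs. -/
def IsPseudoGCO (k : ℕ) (S : Finset ℕ) (σ : Finset ℕ → List ℕ) : Prop :=
  if S.card ≤ k + 2 then
    ∃ base : List ℕ, base.Nodup ∧ base.toFinset = S ∧
      ∀ I : Finset ℕ, I ⊆ S → I.card = k - 2 →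
        DihEquiv (σ I) (base.filter (fun x => x ∉ I))
  else
    ∀ i ∈ S, IsPseudoGCO k (S.erase i) (fun I => (σ I).filter (fun x => x ≠ i))
termination_by S.card
decreasing_by exact Finset.card_erase_lt_of_mem ‹_›

/-- Setoid identifying two `(k, S.card)` pre-GCO representatives when all of their
relevant components are dihedrally equivalent, i.e. when they represent the same
generalized color ordering. -/
def gcoSetoid (k : ℕ) (S : Finset ℕ) (P : (Finset ℕ → List ℕ) → Prop) :
    Setoid {σ : Finset ℕ → List ℕ // P σ} where
  r σ τ := ∀ I : Finset ℕ, I ⊆ S → I.card = k - 2 → DihEquiv (σ.1 I) (τ.1 I)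
  iseqv :=
    ⟨fun σ I _ _ => dihEquiv_refl (σ.1 I),
     fun h I hI hc => dihEquiv_symm (h I hI hc),
     fun h h' I hI hc => dihEquiv_trans (h I hI hc) (h' I hI hc)⟩

theorem dihEquiv_map {α β : Type*} (f : α → β) {l₁ l₂ : List α} (h : DihEquiv l₁ l₂) :
    DihEquiv (l₁.map f) (l₂.map f) := by
  rcases h with h | h
  · exact Or.inl (h.map f)
  · right
    have h2 := h.map f
    rw [List.map_reverse] at h2
    exact h2

/-- Relabeling relation on `(k, S.card)` pre-GCO representatives: `τ` is obtained from
`σ` by a permutation `ρ` of the label set `S`, which sends the component at `I` to the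
component at the image of `I`, relabeled by `ρ`. -/
def RelabelRel (k : ℕ) (S : Finset ℕ) (σ τ : Finset ℕ → List ℕ) : Prop :=
  ∃ ρ : Equiv.Perm ℕ, (∀ x : ℕ, x ∈ S ↔ ρ x ∈ S) ∧
    ∀ I : Finset ℕ, I ⊆ S → I.card = k - 2 →
      DihEquiv ((σ (I.image ρ.symm)).map ρ) (τ I)

theorem relabelRel_refl (k : ℕ) (S : Finset ℕ) (σ : Finset ℕ → List ℕ) :
    RelabelRel k S σ σ :=
  ⟨Equiv.refl ℕ, fun _ => Iff.rfl, fun I _ _ => by simpa using dihEquiv_refl (σ I)⟩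

theorem relabelRel_symm {k : ℕ} {S : Finset ℕ} {σ τ : Finset ℕ → List ℕ}
    (h : RelabelRel k S σ τ) : RelabelRel k S τ σ := by
  obtain ⟨ρ, hmem, hcomp⟩ := h
  refine ⟨ρ.symm, fun x => ?_, fun I hI hc => ?_⟩
  · have := hmem (ρ.symm x)
    simpa using this.symm
  · have hI' : I.image ρ ⊆ S := by
      intro x hx
      obtain ⟨y, hy, rfl⟩ := Finset.mem_image.mp hx
      exact (hmem y).mp (hI hy)
    have hc' : (I.image ρ).card = k - 2 := by
      rw [Finset.card_image_of_injective _ ρ.injective]; exact hc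
    have h1 := hcomp (I.image ρ) hI' hc'
    have hII : (I.image ρ).image ρ.symm = I := by
      rw [Finset.image_image]
      simp
    rw [hII] at h1
    have h2 := dihEquiv_map ρ.symm (dihEquiv_symm h1)
    have h3 : ((σ I).map ρ).map ρ.symm = σ I := by
      rw [List.map_map]
      simp
    rw [h3] at h2
    simpa using h2

theorem relabelRel_trans {k : ℕ} {S : Finset ℕ} {σ τ υ : Finset ℕ → List ℕ}
    (h : RelabelRel k S σ τ) (h' : RelabelRel k S τ υ) : RelabelRel k S σ υ := by
  obtain ⟨ρ, hmem, hcomp⟩ := h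
  obtain ⟨ρ', hmem', hcomp'⟩ := h'
  refine ⟨ρ.trans ρ', fun x => (hmem x).trans (hmem' (ρ x)), fun I hI hc => ?_⟩
  have hI₁ : I.image ρ'.symm ⊆ S := by
    intro x hx
    obtain ⟨y, hy, rfl⟩ := Finset.mem_image.mp hx
    have := hmem' (ρ'.symm y)
    simp only [Equiv.apply_symm_apply] at this
    exact this.mpr (hI hy)
  have hc₁ : (I.image ρ'.symm).card = k - 2 := by
    rw [Finset.card_image_of_injective _ ρ'.symm.injective]; exact hc
  have h1 := hcomp (I.image ρ'.symm) hI₁ hc₁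
  have h2 := dihEquiv_map ρ' h1
  have h3 := hcomp' I hI hc
  have key : ((σ (((I.image ρ'.symm)).image ρ.symm)).map ρ).map ρ' =
      (σ (I.image (ρ.trans ρ').symm)).map (ρ.trans ρ') := by
    rw [List.map_map, Finset.image_image]
    rfl
  rw [key] at h2
  exact dihEquiv_trans h2 h3

/-- Setoid whose classes are the orbits of the relabeling action of the symmetric group
of `S` on generalized color orderings. -/
def gcoOrbitSetoid (k : ℕ) (S : Finset ℕ) (P : (Finset ℕ → List ℕ) → Prop) :
    Setoid {σ : Finset ℕ → List ℕ // P σ} where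
  r σ τ := RelabelRel k S σ.1 τ.1
  iseqv := ⟨fun σ => relabelRel_refl k S σ.1, relabelRel_symm, relabelRel_trans⟩

/-- The natural projection sending a generalized color ordering to its relabeling
orbit. -/
def toOrbit (k : ℕ) (S : Finset ℕ) (P : (Finset ℕ → List ℕ) → Prop) :
    Quotient (gcoSetoid k S P) → Quotient (gcoOrbitSetoid k S P) :=
  Quotient.map' id (fun σ τ h =>
    ⟨Equiv.refl ℕ, fun x => Iff.rfl, fun I hI hc => by simpa using h I hI hc⟩)

/-- Sum of `2 ^ (a + b)` over the consecutive pairs of the walk `y, l, x`. -/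
def walkWeight (x : ℕ) : ℕ → List ℕ → ℕ
  | y, [] => 2 ^ (y + x)
  | y, z :: l => 2 ^ (y + z) + walkWeight x z l

/-- Sum of `2 ^ (a + b)` over the cyclically adjacent pairs of a word. -/
def cycWeight : List ℕ → ℕ
  | [] => 0
  | x :: l => walkWeight x x l

/-- The label set `{1, …, 6}` as a list. -/
def labels : List ℕ := [1, 2, 3, 4, 5, 6]

/-- The words over the letters of `T` that start with the head of `T` and whose second letter
is smaller than the last one: one representative for every dihedral class. -/
def cycReps : List ℕ → List (List ℕ)
  | [] => [[]]
  | x :: r => (r.permutations'.filter fun p => p.headD 0 < p.getLastD 0).map (x :: ·)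

instance (l₁ l₂ : List ℕ) : Decidable (DihEquiv l₁ l₂) :=
  inferInstanceAs (Decidable (_ ∨ _))

/-- The function sending `i` to the `i`-th entry of `p`. -/
def wordFun (p : List ℕ) (i : ℕ) : ℕ :=
  p.getD (i - 1) 0

/-- A number recording the weights of the component words `c i`, relabeled by `f`. -/
def code (f : ℕ → ℕ) (c : ℕ → List ℕ) : ℕ :=
  (labels.map fun i => 2 ^ (14 * f i) * cycWeight ((c i).map f)).sum

/-- Insertion into a binary search tree. -/
def treeInsert (a : ℕ) : BinaryTree ℕ → BinaryTree ℕ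
  | .nil => .node a .nil .nil
  | .node b l r =>
    if a < b then .node b (treeInsert a l) r
    else if b < a then .node b l (treeInsert a r)
    else .node b l r

/-- The entries of a binary tree, in order. -/
def treeToList : BinaryTree ℕ → List ℕ
  | .nil => []
  | .node a l r => treeToList l ++ a :: treeToList r

/-- The codes of all relabelings of `c`, without repetitions. -/
def orbitCodes (c : ℕ → List ℕ) : List ℕ :=
  treeToList ((labels.permutations'.map fun p => code (wordFun p) c).foldr treeInsert .nil)

/-- Representatives of the four orbits. -/
def orbitRep : Fin 4 → ℕ → List ℕ
  | 0, i => labels.erase i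
  | 1, i => [[], [2, 3, 4, 5, 6], [1, 3, 4, 5, 6], [1, 2, 4, 5, 6], [1, 2, 3, 6, 5],
      [1, 2, 3, 6, 4], [1, 2, 3, 5, 4]].getD i []
  | 2, i => [[], [2, 3, 4, 5, 6], [1, 3, 4, 5, 6], [1, 2, 4, 6, 5], [1, 2, 3, 6, 5],
      [1, 2, 6, 3, 4], [1, 2, 5, 3, 4]].getD i []
  | 3, i => [[], [2, 3, 4, 5, 6], [1, 3, 5, 4, 6], [1, 2, 5, 6, 4], [1, 3, 6, 2, 5],
      [1, 4, 2, 3, 6], [1, 2, 4, 3, 5]].getD i []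

/-- The words `c` and `b` agree, up to weight, after deleting `j` from `c` and `i` from `b`. -/
def Compat (c b : List ℕ) (i j : ℕ) : Prop :=
  cycWeight (c.filter (· ≠ j)) = cycWeight (b.filter (· ≠ i))

instance (c b : List ℕ) (i j : ℕ) : Decidable (Compat c b i j) :=
  inferInstanceAs (Decidable (_ = _))

/-- The component words `c i`, relabeled by `ρ`. -/
def relabeled (ρ : Equiv.Perm ℕ) (c : ℕ → List ℕ) (i : ℕ) : List ℕ :=
  (c (ρ.symm i)).map ρ

/-- The words `c i` represent the components of a pre-GCO on `{1, …, 6}`. -/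
def IsComponents (c : ℕ → List ℕ) : Prop :=
  ∀ i ∈ labels, (c i).Perm (labels.erase i)

/-- Every projection of `c` is the descendant of a cyclic word. -/
def HasBases (c : ℕ → List ℕ) : Prop :=
  ∀ i ∈ labels, ∃ b : List ℕ, b.Perm (labels.erase i) ∧
    ∀ j ∈ labels, j ≠ i → DihEquiv ((c j).filter (· ≠ i)) (b.filter (· ≠ j))

/-- If every projection of `c` has, up to weights, a base, then `c` lies in one of the four
orbits. -/
def LiesInOrbit (c : ℕ → List ℕ) : Prop :=
  (∀ i ∈ labels, ∃ b ∈ cycReps (labels.erase i), ∀ j ∈ labels, j ≠ i → Compat (c j) b j i) →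
    ∃ k, code id c ∈ orbitCodes (orbitRep k)

instance (c : ℕ → List ℕ) : Decidable (LiesInOrbit c) :=
  inferInstanceAs (Decidable (_ → _))

theorem walkWeight_append (x y z : ℕ) (l : List ℕ) :
    walkWeight x y (l ++ [z]) = walkWeight z y l + 2 ^ (z + x) := by
  induction l generalizing y with
  | nil => rfl
  | cons a l ih => simp only [List.cons_append, walkWeight, ih, Nat.add_assoc]

theorem walkWeight_reverse (x y : ℕ) (l : List ℕ) :
    walkWeight x y l.reverse = walkWeight y x l := by
  induction l generalizing x with
  | nil => simp [walkWeight, Nat.add_comm]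
  | cons a l ih =>
    rw [List.reverse_cons, walkWeight_append, ih, walkWeight, Nat.add_comm, Nat.add_comm a x]

theorem cycWeight_rotate_one (l : List ℕ) : cycWeight (l.rotate 1) = cycWeight l := by
  match l with
  | [] => rfl
  | [x] => rw [List.rotate_singleton]
  | x :: y :: l =>
    rw [List.rotate_cons_succ, List.rotate_zero, List.cons_append, cycWeight, cycWeight,
      walkWeight_append, walkWeight, Nat.add_comm]

theorem cycWeight_isRotated {l l' : List ℕ} (h : l ~r l') : cycWeight l = cycWeight l' := by
  obtain ⟨n, rfl⟩ := h
  induction n with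
  | zero => rw [List.rotate_zero]
  | succ n ih => rw [← List.rotate_rotate, cycWeight_rotate_one, ih]

theorem cycWeight_reverse (l : List ℕ) : cycWeight l.reverse = cycWeight l := by
  cases l with
  | nil => rfl
  | cons x l =>
    have h : x :: l.reverse ~r (x :: l).reverse := by
      rw [List.reverse_cons]
      exact ⟨1, by simp⟩
    rw [← cycWeight_isRotated h, cycWeight, cycWeight, walkWeight_reverse]

theorem DihEquiv.cycWeight_eq {l l' : List ℕ} (h : DihEquiv l l') :
    cycWeight l = cycWeight l' := by
  rcases h with h | h
  · exact cycWeight_isRotated h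
  · rw [← cycWeight_isRotated h, cycWeight_reverse]

theorem DihEquiv.perm {α : Type*} {l l' : List α} (h : DihEquiv l l') : l.Perm l' := by
  rcases h with h | h
  · exact h.perm
  · exact l.reverse_perm.symm.trans h.perm

theorem List.IsRotated.filter {α : Type*} {l l' : List α} (p : α → Bool) (h : l ~r l') :
    l.filter p ~r l'.filter p := by
  obtain ⟨n, rfl⟩ := h
  rw [List.rotate_eq_drop_append_take_mod, List.filter_append]
  conv_lhs => rw [← List.take_append_drop (n % l.length) l, List.filter_append]
  exact List.isRotated_append

theorem DihEquiv.filter {α : Type*} {l l' : List α} (p : α → Bool) (h : DihEquiv l l') :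
    DihEquiv (l.filter p) (l'.filter p) := by
  rcases h with h | h
  · exact Or.inl (h.filter p)
  · exact Or.inr (by simpa only [List.filter_reverse] using h.filter p)

theorem mem_treeInsert (a b : ℕ) (t : BinaryTree ℕ) :
    b ∈ treeToList (treeInsert a t) ↔ b = a ∨ b ∈ treeToList t := by
  induction t with
  | nil => simp [treeInsert, treeToList]
  | node c l r ihl ihr =>
    rw [treeInsert]
    split_ifs with h h'
    · simp [treeToList, ihl, or_assoc]
    · simp only [treeToList, ihr, List.mem_append, List.mem_cons]
      tauto
    · obtain rfl : a = c := by lia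
      simp only [treeToList, List.mem_append, List.mem_cons]
      tauto

theorem mem_orbitCodes (c : ℕ → List ℕ) (n : ℕ) :
    n ∈ orbitCodes c ↔ ∃ p : List ℕ, p.Perm labels ∧ code (wordFun p) c = n := by
  have key (L : List ℕ) : n ∈ treeToList (L.foldr treeInsert .nil) ↔ n ∈ L := by
    induction L with
    | nil => simp [treeToList]
    | cons a L ih => rw [List.foldr_cons, mem_treeInsert, ih, List.mem_cons]
  rw [orbitCodes, key, List.mem_map]
  simp only [List.mem_permutations']

theorem exists_mem_cycReps :
    ∀ T ∈ labels.sublistsLen 4 ++ labels.sublistsLen 5, ∀ l ∈ T.permutations',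
      ∃ a ∈ cycReps T, DihEquiv l a := by
  decide +kernel

theorem eq_of_mem_cycReps :
    ∀ T ∈ labels.sublistsLen 4 ++ labels.sublistsLen 5, ∀ a ∈ cycReps T, ∀ a' ∈ cycReps T,
      cycWeight a = cycWeight a' → a = a' := by
  decide +kernel

theorem perm_and_weight_of_mem_cycReps :
    ∀ i ∈ labels, ∀ a ∈ cycReps (labels.erase i),
      cycWeight a < 2 ^ 14 ∧ a.Perm (labels.erase i) := by
  decide +kernel

theorem orbitCodes_orbitRep (k : Fin 4) :
    (orbitCodes (orbitRep k)).length = ![60, 180, 120, 12] k ∧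
    (orbitCodes (orbitRep k)).IsChain (· < ·) ∧
    ∀ k' ≠ k, code id (orbitRep k') ∉ orbitCodes (orbitRep k) := by
  decide +kernel +revert

theorem orbitRep_components (k : Fin 4) : IsComponents (orbitRep k) := by
  unfold IsComponents
  decide +kernel +revert

theorem orbitRep_bases (k : Fin 4) :
    ∀ i ∈ labels, ∃ b ∈ cycReps (labels.erase i),
      ∀ j ∈ labels, j ≠ i → DihEquiv ((orbitRep k j).filter (· ≠ i)) (b.filter (· ≠ j)) := by
  decide +kernel +revert

theorem liesInOrbit_of_compat :
    ∀ b₂ ∈ cycReps (labels.erase 2),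
    ∀ c₃ ∈ cycReps (labels.erase 3), Compat c₃ [2, 3, 4, 5, 6] 3 1 → Compat c₃ b₂ 3 2 →
    ∀ c₄ ∈ cycReps (labels.erase 4), Compat c₄ [2, 3, 4, 5, 6] 4 1 → Compat c₄ b₂ 4 2 →
    ∀ c₅ ∈ cycReps (labels.erase 5), Compat c₅ [2, 3, 4, 5, 6] 5 1 → Compat c₅ b₂ 5 2 →
    ∀ c₆ ∈ cycReps (labels.erase 6), Compat c₆ [2, 3, 4, 5, 6] 6 1 → Compat c₆ b₂ 6 2 →
    ∀ b₃ ∈ cycReps (labels.erase 3), Compat c₄ b₃ 4 3 ∧ Compat c₅ b₃ 5 3 ∧ Compat c₆ b₃ 6 3 →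
    ∀ c₁ ∈ cycReps (labels.erase 1), Compat c₁ b₂ 1 2 ∧ Compat c₁ b₃ 1 3 →
    ∀ c₂ ∈ cycReps (labels.erase 2), Compat c₂ [2, 3, 4, 5, 6] 2 1 ∧ Compat c₂ b₃ 2 3 →
    LiesInOrbit fun i => [[], c₁, c₂, c₃, c₄, c₅, c₆].getD i [] := by
  decide +kernel

theorem dihEquiv_of_cycWeight_eq {T l l' : List ℕ}
    (hT : T ∈ labels.sublistsLen 4 ++ labels.sublistsLen 5) (h : l.Perm T) (h' : l'.Perm T)
    (hw : cycWeight l = cycWeight l') : DihEquiv l l' := by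
  obtain ⟨a, ha, hla⟩ := exists_mem_cycReps T hT l (List.mem_permutations'.2 h)
  obtain ⟨a', ha', hla'⟩ := exists_mem_cycReps T hT l' (List.mem_permutations'.2 h')
  obtain rfl : a = a' := eq_of_mem_cycReps T hT a ha a' ha'
    (by rw [← hla.cycWeight_eq, hw, hla'.cycWeight_eq])
  exact dihEquiv_trans hla (dihEquiv_symm hla')

theorem erase_mem_sublistsLen :
    ∀ i ∈ labels, labels.erase i ∈ labels.sublistsLen 4 ++ labels.sublistsLen 5 := by
  decide

theorem exists_rep_of_perm_erase {i : ℕ} (hi : i ∈ labels) {l : List ℕ}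
    (h : l.Perm (labels.erase i)) : ∃ a ∈ cycReps (labels.erase i), DihEquiv l a :=
  exists_mem_cycReps _ (erase_mem_sublistsLen i hi) l (List.mem_permutations'.2 h)

theorem IsComponents.dihEquiv_of_code_eq {c c' : ℕ → List ℕ} (hc : IsComponents c)
    (hc' : IsComponents c') (h : code id c = code id c') :
    ∀ i ∈ labels, DihEquiv (c i) (c' i) := by
  have bound {c : ℕ → List ℕ} (hc : IsComponents c) : ∀ i ∈ labels, cycWeight (c i) < 2 ^ 14 := by
    intro i hi
    obtain ⟨a, ha, hca⟩ := exists_rep_of_perm_erase hi (hc i hi)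
    rw [hca.cycWeight_eq]
    exact (perm_and_weight_of_mem_cycReps i hi a ha).1
  have key : ∀ i ∈ labels, cycWeight (c i) = cycWeight (c' i) := by
    have b := bound hc
    have b' := bound hc'
    simp only [code, labels, List.map_cons, List.map_nil, List.sum_cons, List.sum_nil, id_eq,
      List.map_id, List.forall_mem_cons] at h b b' ⊢
    simp only [List.not_mem_nil, false_imp_iff, implies_true, and_true] at b b' ⊢
    norm_num at h b b'
    omega
  exact fun i hi => dihEquiv_of_cycWeight_eq (erase_mem_sublistsLen i hi) (hc i hi) (hc' i hi)
    (key i hi)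

theorem code_congr {f : ℕ → ℕ} {c c' : ℕ → List ℕ} (h : ∀ i ∈ labels, DihEquiv (c i) (c' i)) :
    code f c = code f c' := by
  unfold code
  congr 1
  exact List.map_congr_left fun i hi => by rw [(dihEquiv_map f (h i hi)).cycWeight_eq]

theorem IsComponents.code_congr_fun {f g : ℕ → ℕ} {c : ℕ → List ℕ} (hc : IsComponents c)
    (h : ∀ i ∈ labels, f i = g i) : code f c = code g c := by
  unfold code
  congr 1
  refine List.map_congr_left fun i hi => ?_
  rw [h i hi, List.map_congr_left fun x hx => h x (List.mem_of_mem_erase ((hc i hi).subset hx))]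

theorem nodup_labels : labels.Nodup := by decide

theorem map_perm_labels {ρ : Equiv.Perm ℕ} (hρ : ∀ x, x ∈ labels ↔ ρ x ∈ labels) :
    (labels.map ρ).Perm labels := by
  refine (List.perm_ext_iff_of_nodup (nodup_labels.map ρ.injective) nodup_labels).2 fun x => ?_
  rw [List.mem_map]
  constructor
  · rintro ⟨y, hy, rfl⟩
    exact (hρ y).1 hy
  · exact fun hx => ⟨ρ.symm x, (hρ _).2 (by simpa using hx), by simp⟩

theorem symm_preserves {ρ : Equiv.Perm ℕ} (hρ : ∀ x, x ∈ labels ↔ ρ x ∈ labels) (x : ℕ) :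
    x ∈ labels ↔ ρ.symm x ∈ labels := by
  rw [hρ (ρ.symm x), Equiv.apply_symm_apply]

theorem code_relabeled {ρ : Equiv.Perm ℕ} (hρ : ∀ x, x ∈ labels ↔ ρ x ∈ labels)
    (c : ℕ → List ℕ) : code id (relabeled ρ c) = code ρ c := by
  unfold code
  rw [← ((map_perm_labels hρ).map _).sum_eq, List.map_map]
  simp [Function.comp_def, relabeled]

theorem map_erase_labels_perm {ρ : Equiv.Perm ℕ} (hρ : ∀ x, x ∈ labels ↔ ρ x ∈ labels) (i : ℕ) :
    ((labels.erase i).map ρ).Perm (labels.erase (ρ i)) := by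
  rw [List.map_erase ρ.injective]
  exact (map_perm_labels hρ).erase _

theorem IsComponents.relabeled {ρ : Equiv.Perm ℕ} (hρ : ∀ x, x ∈ labels ↔ ρ x ∈ labels)
    {c : ℕ → List ℕ} (hc : IsComponents c) : IsComponents (relabeled ρ c) := by
  intro i hi
  have h := ((hc _ ((symm_preserves hρ i).1 hi)).map ρ).trans (map_erase_labels_perm hρ _)
  rwa [Equiv.apply_symm_apply] at h

theorem map_filter_ne (ρ : Equiv.Perm ℕ) (l : List ℕ) (i : ℕ) :
    (l.map ρ).filter (· ≠ i) = (l.filter (· ≠ ρ.symm i)).map ρ := by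
  rw [List.filter_map]
  congr 2
  ext x
  simp [Equiv.eq_symm_apply]

theorem isBase_map {ρ : Equiv.Perm ℕ} (hρ : ∀ x, x ∈ labels ↔ ρ x ∈ labels)
    {c : ℕ → List ℕ} {b : List ℕ} {i : ℕ}
    (h : ∀ j ∈ labels, j ≠ i → DihEquiv ((c j).filter (· ≠ i)) (b.filter (· ≠ j))) :
    ∀ j ∈ labels, j ≠ ρ i →
      DihEquiv ((relabeled ρ c j).filter (· ≠ ρ i)) ((b.map ρ).filter (· ≠ j)) := by
  intro j hj hji
  rw [relabeled, map_filter_ne, map_filter_ne, Equiv.symm_apply_apply]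
  exact dihEquiv_map ρ (h _ ((symm_preserves hρ j).1 hj) fun e => hji (by simp [← e]))

theorem HasBases.relabeled {ρ : Equiv.Perm ℕ} (hρ : ∀ x, x ∈ labels ↔ ρ x ∈ labels)
    {c : ℕ → List ℕ} (hc : HasBases c) : HasBases (relabeled ρ c) := by
  intro i hi
  obtain ⟨b, hb, h⟩ := hc _ ((symm_preserves hρ i).1 hi)
  have h1 := (hb.map ρ).trans (map_erase_labels_perm hρ _)
  have h2 := isBase_map hρ h
  rw [Equiv.apply_symm_apply] at h1 h2
  exact ⟨b.map ρ, h1, h2⟩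

theorem wordFun_map (f : ℕ → ℕ) : ∀ i ∈ labels, wordFun (labels.map f) i = f i := by
  simp [labels, wordFun]

theorem exists_perm_of_perm_labels {p : List ℕ} (hp : p.Perm labels) :
    ∃ ρ : Equiv.Perm ℕ, (∀ x, x ∈ labels ↔ ρ x ∈ labels) ∧ ∀ x ∈ labels, wordFun p x = ρ x := by
  have hlen : p.length = 6 := hp.length_eq
  have hpos : ∀ x ∈ labels, 1 ≤ x ∧ x - 1 < p.length := by
    rw [hlen]
    decide
  have hmem : ∀ x ∈ labels, wordFun p x ∈ labels := fun x hx => by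
    rw [wordFun, List.getD_eq_getElem _ _ (hpos x hx).2]
    exact hp.subset (List.getElem_mem _)
  let g : {x // x ∈ labels} → {x // x ∈ labels} := fun x => ⟨wordFun p x, hmem x x.2⟩
  have hg : Function.Injective g := by
    rintro ⟨x, hx⟩ ⟨y, hy⟩ h
    have h' : wordFun p x = wordFun p y := congrArg Subtype.val h
    rw [wordFun, wordFun, List.getD_eq_getElem _ _ (hpos x hx).2,
      List.getD_eq_getElem _ _ (hpos y hy).2,
      (hp.nodup_iff.2 nodup_labels).getElem_inj_iff] at h'
    have := hpos x hx
    have := hpos y hy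
    exact Subtype.ext (by lia)
  let e : Equiv.Perm {x // x ∈ labels} := Equiv.ofBijective g hg.bijective_of_finite
  refine ⟨Equiv.Perm.ofSubtype e, fun x => ?_, fun x hx => ?_⟩
  · exact (Equiv.Perm.ofSubtype_apply_mem_iff_mem e x).symm
  · rw [Equiv.Perm.ofSubtype_apply_of_mem e hx]
    rfl

theorem mem_labels {x : ℕ} : x ∈ labels ↔ x ∈ Finset.Icc 1 6 := by
  rw [show Finset.Icc 1 6 = labels.toFinset by decide, List.mem_toFinset]

theorem toFinset_erase_labels (i : ℕ) :
    (labels.erase i).toFinset = (Finset.Icc 1 6).erase i := by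
  ext x
  rw [List.mem_toFinset, nodup_labels.mem_erase_iff, Finset.mem_erase, mem_labels]

theorem perm_erase_labels_iff {l : List ℕ} {i : ℕ} :
    l.Perm (labels.erase i) ↔ l.Nodup ∧ l.toFinset = (Finset.Icc 1 6).erase i := by
  rw [← toFinset_erase_labels]
  constructor
  · exact fun h => ⟨h.nodup_iff.2 (nodup_labels.erase i), List.toFinset_eq_of_perm _ _ h⟩
  · exact fun h => List.perm_of_nodup_nodup_toFinset_eq h.1 (nodup_labels.erase i) h.2

theorem forall_card_eq_one_iff {S : Finset ℕ} {Q : Finset ℕ → Prop} :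
    (∀ I : Finset ℕ, I ⊆ S → I.card = 3 - 2 → Q I) ↔ ∀ i ∈ S, Q {i} := by
  constructor
  · exact fun h i hi => h {i} (Finset.singleton_subset_iff.2 hi) (Finset.card_singleton i)
  · intro h I hI hc
    obtain ⟨i, rfl⟩ := Finset.card_eq_one.1 hc
    exact h i (Finset.singleton_subset_iff.1 hI)

theorem isPreGCO_iff {σ : Finset ℕ → List ℕ} :
    IsPreGCO 3 (Finset.Icc 1 6) σ ↔ IsComponents fun i => σ {i} := by
  simp only [IsPreGCO, forall_card_eq_one_iff, IsComponents, perm_erase_labels_iff, mem_labels,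
    Finset.sdiff_singleton_eq_erase]

theorem isPseudoGCO_iff {σ : Finset ℕ → List ℕ} :
    IsPseudoGCO 3 (Finset.Icc 1 6) σ ↔ HasBases fun i => σ {i} := by
  rw [IsPseudoGCO, if_neg (by simp), HasBases]
  simp only [mem_labels]
  refine forall₂_congr fun i hi => ?_
  rw [IsPseudoGCO, if_pos (by simp [Finset.card_erase_of_mem hi])]
  simp only [forall_card_eq_one_iff, perm_erase_labels_iff, and_assoc, Finset.mem_erase,
    Finset.mem_singleton, and_imp]
  grind

/-- The property of representing a `(3, 6)` pseudo-GCO. -/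
abbrev IsPseudo (σ : Finset ℕ → List ℕ) : Prop :=
  IsPreGCO 3 (Finset.Icc 1 6) σ ∧ IsPseudoGCO 3 (Finset.Icc 1 6) σ

theorem isPseudo_iff {σ : Finset ℕ → List ℕ} :
    IsPseudo σ ↔ (IsComponents fun i => σ {i}) ∧ HasBases fun i => σ {i} :=
  and_congr isPreGCO_iff isPseudoGCO_iff

theorem relabelRel_iff {σ τ : Finset ℕ → List ℕ} :
    RelabelRel 3 (Finset.Icc 1 6) σ τ ↔
      ∃ ρ : Equiv.Perm ℕ, (∀ x, x ∈ labels ↔ ρ x ∈ labels) ∧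
        ∀ i ∈ labels, DihEquiv (relabeled ρ (fun i => σ {i}) i) (τ {i}) := by
  simp only [RelabelRel, forall_card_eq_one_iff, mem_labels, Finset.image_singleton, relabeled]

/-- The pre-GCO with component words `c i`. -/
def ofWords (c : ℕ → List ℕ) (I : Finset ℕ) : List ℕ :=
  c (∑ i ∈ I, i)

@[simp] theorem ofWords_singleton (c : ℕ → List ℕ) (i : ℕ) : ofWords c {i} = c i := by
  simp [ofWords]

theorem isPseudo_ofWords {c : ℕ → List ℕ} (hc : IsComponents c) (hb : HasBases c) :
    IsPseudo (ofWords c) := by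
  simpa only [isPseudo_iff, ofWords_singleton] using And.intro hc hb

theorem relabelRel_iff_code_mem {σ τ : Finset ℕ → List ℕ} (hσ : IsPseudo σ) (hτ : IsPseudo τ) :
    RelabelRel 3 (Finset.Icc 1 6) σ τ ↔
      code id (fun i => τ {i}) ∈ orbitCodes fun i => σ {i} := by
  rw [isPseudo_iff] at hσ hτ
  rw [relabelRel_iff, mem_orbitCodes]
  constructor
  · rintro ⟨ρ, hρ, h⟩
    refine ⟨labels.map ρ, map_perm_labels hρ, ?_⟩
    rw [hσ.1.code_congr_fun (wordFun_map ρ), ← code_relabeled hρ, code_congr h]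
  · rintro ⟨p, hp, h⟩
    obtain ⟨ρ, hρ, hpρ⟩ := exists_perm_of_perm_labels hp
    rw [hσ.1.code_congr_fun hpρ, ← code_relabeled hρ] at h
    exact ⟨ρ, hρ, (hσ.1.relabeled hρ).dihEquiv_of_code_eq hτ.1 h⟩

theorem exists_isPseudo_of_mem_orbitCodes {σ : Finset ℕ → List ℕ} (hσ : IsPseudo σ) {n : ℕ}
    (hn : n ∈ orbitCodes fun i => σ {i}) :
    ∃ τ, IsPseudo τ ∧ code id (fun i => τ {i}) = n := by
  rw [isPseudo_iff] at hσ
  obtain ⟨p, hp, rfl⟩ := (mem_orbitCodes _ _).1 hn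
  obtain ⟨ρ, hρ, hpρ⟩ := exists_perm_of_perm_labels hp
  refine ⟨_, isPseudo_ofWords (hσ.1.relabeled hρ) (hσ.2.relabeled hρ), ?_⟩
  simp only [ofWords_singleton]
  rw [hσ.1.code_congr_fun hpρ, ← code_relabeled hρ]

theorem isPseudo_orbitRep (k : Fin 4) : IsPseudo (ofWords (orbitRep k)) := by
  refine isPseudo_ofWords (orbitRep_components k) fun i hi => ?_
  obtain ⟨b, hb, h⟩ := orbitRep_bases k i hi
  exact ⟨b, (perm_and_weight_of_mem_cycReps i hi b hb).2, h⟩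

theorem compat_of_dihEquiv {c a b b' : List ℕ} {i j : ℕ} (ha : DihEquiv c a) (hb : DihEquiv b b')
    (h : DihEquiv (c.filter (· ≠ i)) (b.filter (· ≠ j))) : Compat a b' j i := by
  rw [Compat, ← (ha.filter _).cycWeight_eq, h.cycWeight_eq, (hb.filter _).cycWeight_eq]

theorem exists_code_mem_of_isBase {c : ℕ → List ℕ} (hc : IsComponents c) (hb : HasBases c)
    (h₁ : ∀ j ∈ labels, j ≠ 1 →
      DihEquiv ((c j).filter (· ≠ 1)) ([2, 3, 4, 5, 6].filter (· ≠ j))) :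
    ∃ k, code id c ∈ orbitCodes (orbitRep k) := by
  have hca : ∀ i, ∃ a, i ∈ labels → a ∈ cycReps (labels.erase i) ∧ DihEquiv (c i) a := by
    intro i
    by_cases hi : i ∈ labels
    · obtain ⟨a, ha⟩ := exists_rep_of_perm_erase hi (hc i hi)
      exact ⟨a, fun _ => ha⟩
    · exact ⟨[], fun h => (hi h).elim⟩
  choose a ha using hca
  have hbase : ∀ i ∈ labels, ∃ b ∈ cycReps (labels.erase i),
      ∀ j ∈ labels, j ≠ i → Compat (a j) b j i := by
    intro i hi
    obtain ⟨b, hbp, hbi⟩ := hb i hi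
    obtain ⟨b', hb', hbb'⟩ := exists_rep_of_perm_erase hi hbp
    exact ⟨b', hb', fun j hj hji => compat_of_dihEquiv (ha j hj).2 hbb' (hbi j hj hji)⟩
  have ha₁ : ∀ j ∈ labels, j ≠ 1 → Compat (a j) [2, 3, 4, 5, 6] j 1 := fun j hj hj1 =>
    compat_of_dihEquiv (ha j hj).2 (dihEquiv_refl _) (h₁ j hj hj1)
  have haa : ∀ i ∈ labels, [[], a 1, a 2, a 3, a 4, a 5, a 6].getD i [] = a i := by
    simp [labels]
  obtain ⟨b₂, hb₂, h₂⟩ := hbase 2 (by decide)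
  obtain ⟨b₃, hb₃, h₃⟩ := hbase 3 (by decide)
  have hm : ∀ i ∈ labels, a i ∈ cycReps (labels.erase i) := fun i hi => (ha i hi).1
  have key := liesInOrbit_of_compat b₂ hb₂
    _ (hm 3 (by decide)) (ha₁ 3 (by decide) (by decide)) (h₂ 3 (by decide) (by decide))
    _ (hm 4 (by decide)) (ha₁ 4 (by decide) (by decide)) (h₂ 4 (by decide) (by decide))
    _ (hm 5 (by decide)) (ha₁ 5 (by decide) (by decide)) (h₂ 5 (by decide) (by decide))
    _ (hm 6 (by decide)) (ha₁ 6 (by decide) (by decide)) (h₂ 6 (by decide) (by decide))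
    b₃ hb₃ ⟨h₃ 4 (by decide) (by decide), h₃ 5 (by decide) (by decide), h₃ 6 (by decide) (by decide)⟩
    _ (hm 1 (by decide)) ⟨h₂ 1 (by decide) (by decide), h₃ 1 (by decide) (by decide)⟩
    _ (hm 2 (by decide)) ⟨ha₁ 2 (by decide) (by decide), h₃ 2 (by decide) (by decide)⟩
  rw [code_congr fun i hi => (ha i hi).2]
  have hcode : code id (fun i => [[], a 1, a 2, a 3, a 4, a 5, a 6].getD i []) = code id a :=
    code_congr fun i hi => by rw [haa i hi]; exact dihEquiv_refl _
  rw [← hcode]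
  refine key fun i hi => ?_
  obtain ⟨b, hb, h⟩ := hbase i hi
  exact ⟨b, hb, fun j hj hji => by simpa only [haa j hj] using h j hj hji⟩

theorem exists_relabelRel_orbitRep {σ : Finset ℕ → List ℕ} (hσ : IsPseudo σ) :
    ∃ k, RelabelRel 3 (Finset.Icc 1 6) (ofWords (orbitRep k)) σ := by
  have hσ' := isPseudo_iff.1 hσ
  obtain ⟨b, hb, hbase⟩ := hσ'.2 1 (by decide)
  have hp : (1 :: b).Perm labels := hb.cons 1
  obtain ⟨ρ, hρ, hbρ⟩ := exists_perm_of_perm_labels hp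
  have hρ' := symm_preserves hρ
  have hmap : labels.map ρ = 1 :: b := by
    rw [← List.map_congr_left hbρ]
    match b, hb.length_eq with
    | [_, _, _, _, _], _ => rfl
  have hρ1 : ρ 1 = 1 := by simpa [labels] using congrArg List.head? hmap
  have hρb : b.map ρ.symm = [2, 3, 4, 5, 6] := by
    have h : b = [2, 3, 4, 5, 6].map ρ := by simpa [labels] using (congrArg List.tail hmap).symm
    rw [h, List.map_map]
    simp
  have hbase' := isBase_map hρ' hbase
  rw [hρb, (Equiv.symm_apply_eq ρ).2 hρ1.symm] at hbase'
  have hc := hσ'.1.relabeled hρ'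
  have hb' := hσ'.2.relabeled hρ'
  obtain ⟨k, hk⟩ := exists_code_mem_of_isBase hc hb' hbase'
  refine ⟨k, relabelRel_trans (τ := ofWords (relabeled ρ.symm fun i => σ {i})) ?_
    (relabelRel_symm (relabelRel_iff.2 ⟨ρ.symm, hρ', fun i _ => ?_⟩))⟩
  · rw [relabelRel_iff_code_mem (isPseudo_orbitRep k) (isPseudo_ofWords hc hb')]
    simpa only [ofWords_singleton] using hk
  · rw [ofWords_singleton]
    exact dihEquiv_refl _

/-- The code of a pseudo-GCO. -/
def quotientCode : Quotient (gcoSetoid 3 (Finset.Icc 1 6) IsPseudo) → ℕ :=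
  Quotient.lift (fun σ => code id fun i => σ.1 {i}) fun _ _ h =>
    code_congr fun i hi => forall_card_eq_one_iff.1 h i (mem_labels.1 hi)

theorem quotientCode_injective : Function.Injective quotientCode := by
  rintro ⟨σ⟩ ⟨τ⟩ h
  refine Quotient.sound (forall_card_eq_one_iff.2 fun i hi => ?_)
  exact (isPseudo_iff.1 σ.2).1.dihEquiv_of_code_eq (isPseudo_iff.1 τ.2).1 h i (mem_labels.2 hi)

/-- The orbit of a representative. -/
def repOrbit (k : Fin 4) : Quotient (gcoOrbitSetoid 3 (Finset.Icc 1 6) IsPseudo) :=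
  Quotient.mk _ ⟨ofWords (orbitRep k), isPseudo_orbitRep k⟩

theorem mk_eq_repOrbit_iff {σ : {σ : Finset ℕ → List ℕ // IsPseudo σ}} {k : Fin 4} :
    Quotient.mk (gcoOrbitSetoid 3 (Finset.Icc 1 6) IsPseudo) σ = repOrbit k ↔
      code id (fun i => σ.1 {i}) ∈ orbitCodes (orbitRep k) := by
  rw [eq_comm, repOrbit, Quotient.eq]
  refine (relabelRel_iff_code_mem (isPseudo_orbitRep k) σ.2).trans ?_
  simp only [ofWords_singleton]

theorem image_quotientCode (k : Fin 4) :
    quotientCode '' {x | toOrbit 3 (Finset.Icc 1 6) IsPseudo x = repOrbit k} =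
      (orbitCodes (orbitRep k)).toFinset := by
  ext n
  rw [Finset.mem_coe, List.mem_toFinset]
  constructor
  · rintro ⟨⟨σ⟩, h, rfl⟩
    exact mk_eq_repOrbit_iff.1 h
  · intro hn
    obtain ⟨τ, hτ, rfl⟩ := exists_isPseudo_of_mem_orbitCodes (isPseudo_orbitRep k)
      (by simpa only [ofWords_singleton] using hn)
    exact ⟨Quotient.mk _ ⟨τ, hτ⟩, mk_eq_repOrbit_iff.2 hn, rfl⟩

theorem card_repOrbit (k : Fin 4) :
    Nat.card {x // toOrbit 3 (Finset.Icc 1 6) IsPseudo x = repOrbit k} =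
      ![60, 180, 120, 12] k := by
  obtain ⟨hlen, hchain, -⟩ := orbitCodes_orbitRep k
  rw [← hlen, ← List.toFinset_card_of_nodup hchain.pairwise.nodup, ← Set.ncard_coe_finset,
    ← image_quotientCode, Set.ncard_image_of_injective _ quotientCode_injective]
  rfl

theorem repOrbit_injective : Function.Injective repOrbit := by
  intro k k' h
  by_contra hne
  refine (orbitCodes_orbitRep k').2.2 k hne ?_
  simpa only [ofWords_singleton] using mk_eq_repOrbit_iff.1 h

theorem repOrbit_surjective : Function.Surjective repOrbit := by
  rintro ⟨σ⟩
  obtain ⟨k, hk⟩ := exists_relabelRel_orbitRep σ.2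
  exact ⟨k, Quotient.sound hk⟩

/-- The symmetric group `S₆` acts on the 372 `(3,6)` pseudo-GCOs on `{1, …, 6}` by
relabeling, with exactly 4 orbits, of sizes 60, 180, 120 and 12. -/
theorem orbits_pseudoGCO_three_six :
    Nat.card (Quotient (gcoOrbitSetoid 3 (Finset.Icc 1 6) (fun σ =>
        IsPreGCO 3 (Finset.Icc 1 6) σ ∧ IsPseudoGCO 3 (Finset.Icc 1 6) σ))) = 4 ∧
    ∃ q₁ q₂ q₃ q₄ : Quotient (gcoOrbitSetoid 3 (Finset.Icc 1 6) (fun σ =>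
        IsPreGCO 3 (Finset.Icc 1 6) σ ∧ IsPseudoGCO 3 (Finset.Icc 1 6) σ)),
      q₁ ≠ q₂ ∧ q₁ ≠ q₃ ∧ q₁ ≠ q₄ ∧ q₂ ≠ q₃ ∧ q₂ ≠ q₄ ∧ q₃ ≠ q₄ ∧
      (∀ q, q = q₁ ∨ q = q₂ ∨ q = q₃ ∨ q = q₄) ∧
      Nat.card {x // toOrbit 3 (Finset.Icc 1 6) _ x = q₁} = 60 ∧
      Nat.card {x // toOrbit 3 (Finset.Icc 1 6) _ x = q₂} = 180 ∧
      Nat.card {x // toOrbit 3 (Finset.Icc 1 6) _ x = q₃} = 120 ∧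
      Nat.card {x // toOrbit 3 (Finset.Icc 1 6) _ x = q₄} = 12 := by
  refine ⟨?_, repOrbit 0, repOrbit 1, repOrbit 2, repOrbit 3, ?_, ?_, ?_, ?_, ?_, ?_, fun q => ?_,
    card_repOrbit 0, card_repOrbit 1, card_repOrbit 2, card_repOrbit 3⟩
  · rw [← Nat.card_eq_of_bijective repOrbit ⟨repOrbit_injective, repOrbit_surjective⟩,
      Nat.card_fin]
  iterate 6 exact repOrbit_injective.ne (by decide)
  obtain ⟨k, rfl⟩ := repOrbit_surjective q
  fin_cases k <;> simp
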